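/- arXiv:2107.03958 — 3 statements merged into one kernel-verified Lean document; each statement's English description precedes it below -/
import Mathlib

section
/- Let f : ℝ² → ℝ be infinitely differentiable with compact support, and define u(x) = −(1/(2π)) ∫_{ℝ²} log ‖x−y‖ f(y) dy. Then u is twice continuously differentiable and −Δu(x) = f(x) for every x ∈ ℝ², where Δu denotes the Laplacian of u (the sum of the two pure second partial derivatives). -/
open MeasureTheory

local notation "E2" => EuclideanSpace ℝ (Fin 2)

theorem logNorm_locInt : LocallyIntegrable (fun x : E2 => Real.log ‖x‖) volume := by
  rw [locallyIntegrable_iff]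
  intro K hK
  obtain ⟨R, hR⟩ := hK.isBounded.subset_ball 0
  refine IntegrableOn.mono_set ?_ hR
  have := (integrableOn_fun_norm_addHaar (volume : Measure E2) (f := Real.log) (r := R))
  rw [this]
  have hc : Continuous (fun y : ℝ => y ^ (Module.finrank ℝ E2 - 1) • Real.log y) := by
    simpa using Real.continuous_mul_log
  exact (hc.integrableOn_Icc (a := 0) (b := R)).mono_set Set.Ioo_subset_Icc_self

theorem kernel_integral : ∫ x : E2, (1 / Real.pi) * ((‖x‖ ^ 2 + 1) ^ 2)⁻¹ = 1 := by
  rw [integral_fun_norm_addHaar volume (fun r : ℝ => (1 / Real.pi) * ((r ^ 2 + 1) ^ 2)⁻¹)]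
  have h1 : ∫ y in Set.Ioi (0:ℝ), (y / (y ^ 2 + 1) ^ 2 : ℝ) = 0 - (-(1/2) * (0 ^ 2 + 1 : ℝ)⁻¹) := by
    apply integral_Ioi_of_hasDerivAt_of_nonneg' (g := fun y : ℝ => -(1/2) * (y ^ 2 + 1)⁻¹)
    · intro x _
      have h0 : x ^ 2 + 1 ≠ 0 := by positivity
      have := ((((hasDerivAt_id x).pow 2).add_const 1).inv h0).const_mul (-(1/2))
      refine HasDerivAt.congr_deriv (f' := _) this ?_
      simp only [Pi.pow_apply, id, Nat.cast_ofNat]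
      field_simp
      try simp
    · intro x hx
      have : 0 < x := hx
      positivity
    · have : Filter.Tendsto (fun y : ℝ => y ^ 2 + 1) Filter.atTop Filter.atTop :=
        Filter.tendsto_atTop_add_const_right _ _ (Filter.tendsto_pow_atTop two_ne_zero)
      simpa using this.inv_tendsto_atTop.const_mul (-(1/2) : ℝ)
  have h2 : ∀ y : ℝ, y ^ (Module.finrank ℝ E2 - 1) • ((1 / Real.pi) * ((y ^ 2 + 1) ^ 2)⁻¹)
      = (1 / Real.pi) * (y / (y ^ 2 + 1) ^ 2) := by
    intro y; simp; ring
  simp_rw [h2]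
  rw [integral_const_mul, h1]
  have := Real.pi_pos
  simp [Measure.real, this.le]

theorem kernel_decay : Filter.Tendsto
    (fun x : E2 => ‖x‖ ^ (Module.finrank ℝ E2) * ((1 / Real.pi) * ((‖x‖ ^ 2 + 1) ^ 2)⁻¹))
    (Bornology.cobounded E2) (nhds 0) := by
  have hn := tendsto_norm_cobounded_atTop (E := E2)
  have h2 : Filter.Tendsto (fun y : ℝ => y ^ 2 + 1) Filter.atTop Filter.atTop :=
        Filter.tendsto_atTop_add_const_right _ _ (Filter.tendsto_pow_atTop two_ne_zero)
  have h3 := (h2.comp hn).inv_tendsto_atTop.const_mul (1 / Real.pi)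
  have hp := Real.pi_pos
  rw [mul_zero] at h3
  refine squeeze_zero (fun x => by positivity) (fun x => ?_) h3
  simp only [finrank_euclideanSpace_fin, Pi.inv_apply, Function.comp]
  rw [mul_left_comm]
  gcongr
  rw [← div_eq_mul_inv, div_le_iff₀ (by positivity), inv_mul_eq_div, le_div_iff₀ (by positivity)]
  nlinarith [sq_nonneg ‖x‖]

/-- regularised logarithm -/
noncomputable def gReg (a : ℝ) (x : EuclideanSpace ℝ (Fin 2)) : ℝ := (1/2) * Real.log (‖x‖ ^ 2 + a)

theorem gReg_contDiff {a : ℝ} (ha : 0 < a) : ContDiff ℝ 2 (gReg a) := by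
  unfold gReg
  refine contDiff_const.mul (ContDiff.log ?_ fun x => by positivity)
  exact (contDiff_norm_sq ℝ).add contDiff_const

theorem gReg_d1 {a : ℝ} (ha : 0 < a) (x : E2) (i : Fin 2) :
    fderiv ℝ (gReg a) x (EuclideanSpace.single i 1) = x i * (‖x‖ ^ 2 + a)⁻¹ := by
  have h := ((((hasStrictFDerivAt_norm_sq x).hasFDerivAt).add_const a).log
    (by positivity)).const_mul (1/2 : ℝ)
  have h' : HasFDerivAt (gReg a) _ x := h
  rw [h'.fderiv]
  simp [EuclideanSpace.inner_single_right]
  ring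

theorem gReg_d2 {a : ℝ} (ha : 0 < a) (x : E2) (i : Fin 2) :
    fderiv ℝ (fun z => fderiv ℝ (gReg a) z (EuclideanSpace.single i 1)) x
      (EuclideanSpace.single i 1)
      = (‖x‖ ^ 2 + a)⁻¹ - 2 * (x i) ^ 2 * ((‖x‖ ^ 2 + a) ^ 2)⁻¹ := by
  simp_rw [gReg_d1 ha]
  have h0 : ‖x‖ ^ 2 + a ≠ 0 := by positivity
  have h1 := (((hasStrictFDerivAt_norm_sq x).hasFDerivAt).add_const a)
  have h2 := (hasDerivAt_inv h0).comp_hasFDerivAt x h1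
  have h3 : HasFDerivAt (fun z : E2 => z i) (EuclideanSpace.proj i : E2 →L[ℝ] ℝ) x :=
    (EuclideanSpace.proj i : E2 →L[ℝ] ℝ).hasFDerivAt
  have h4 : HasFDerivAt (fun z : E2 => z i * (‖z‖ ^ 2 + a)⁻¹) _ x := h3.mul h2
  rw [h4.fderiv]
  simp [EuclideanSpace.inner_single_right]
  ring

theorem gReg_lap {a : ℝ} (ha : 0 < a) (x : E2) :
    fderiv ℝ (fun z => fderiv ℝ (gReg a) z (EuclideanSpace.single 0 1)) x
      (EuclideanSpace.single 0 1)
    + fderiv ℝ (fun z => fderiv ℝ (gReg a) z (EuclideanSpace.single 1 1)) x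
      (EuclideanSpace.single 1 1)
      = 2 * a * ((‖x‖ ^ 2 + a) ^ 2)⁻¹ := by
  rw [gReg_d2 ha, gReg_d2 ha]
  have h0 : ‖x‖ ^ 2 + a ≠ 0 := by positivity
  have h1 : ‖x‖ ^ 2 = x 0 ^ 2 + x 1 ^ 2 := by
    rw [EuclideanSpace.norm_sq_eq]; simp
  field_simp
  rw [h1]; ring

/-- Green's second identity in one direction. -/
theorem green_dir {g φ : E2 → ℝ} (hg : ContDiff ℝ 2 g) (hφ : ContDiff ℝ 2 φ)
    (hs : HasCompactSupport φ) (v : E2) :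
    ∫ t, g t * fderiv ℝ (fun z => fderiv ℝ φ z v) t v
      = ∫ t, fderiv ℝ (fun z => fderiv ℝ g z v) t v * φ t := by
  have hg1 : ContDiff ℝ 1 (fun z => fderiv ℝ g z v) :=
    (hg.fderiv_right (m := 1) (by norm_num)).clm_apply contDiff_const
  have hφ1 : ContDiff ℝ 1 (fun z => fderiv ℝ φ z v) :=
    (hφ.fderiv_right (m := 1) (by norm_num)).clm_apply contDiff_const
  have hg2 : Continuous (fun z => fderiv ℝ (fun z => fderiv ℝ g z v) z v) :=
    (hg1.continuous_fderiv one_ne_zero).clm_apply continuous_const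
  have hφ2 : Continuous (fun z => fderiv ℝ (fun z => fderiv ℝ φ z v) z v) :=
    (hφ1.continuous_fderiv one_ne_zero).clm_apply continuous_const
  have hs1 : HasCompactSupport (fun z => fderiv ℝ φ z v) := hs.fderiv_apply ℝ v
  have hs2 : HasCompactSupport (fun z => fderiv ℝ (fun z => fderiv ℝ φ z v) z v) :=
    hs1.fderiv_apply ℝ v
  rw [integral_mul_fderiv_eq_neg_fderiv_mul_of_integrable
      ((hg1.continuous.mul hφ1.continuous).integrable_of_hasCompactSupport hs1.mul_left)
      ((hg.continuous.mul hφ2).integrable_of_hasCompactSupport hs2.mul_left)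
      ((hg.continuous.mul hφ1.continuous).integrable_of_hasCompactSupport hs1.mul_left)
      (fun x _ => (hg.differentiable two_ne_zero) x)
      (fun x _ => (hφ1.differentiable one_ne_zero) x),
    integral_mul_fderiv_eq_neg_fderiv_mul_of_integrable
      ((hg2.mul hφ.continuous).integrable_of_hasCompactSupport hs.mul_left)
      ((hg1.continuous.mul hφ1.continuous).integrable_of_hasCompactSupport hs1.mul_left)
      ((hg1.continuous.mul hφ.continuous).integrable_of_hasCompactSupport hs.mul_left)
      (fun x _ => (hg1.differentiable one_ne_zero) x)
      (fun x _ => (hφ.differentiable two_ne_zero) x), neg_neg]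

theorem gReg_tendsto {ψ : E2 → ℝ} (hψ : Continuous ψ) (hs : HasCompactSupport ψ) :
    Filter.Tendsto (fun c : ℝ => ∫ t, gReg ((c ^ 2)⁻¹) t * ψ t) Filter.atTop
      (nhds (∫ t, Real.log ‖t‖ * ψ t)) := by
  have hI : Integrable (fun t => |Real.log ‖t‖ * ψ t| + |gReg 1 t * ψ t|) := by
    refine Integrable.add ?_ ?_
    · exact (logNorm_locInt.integrable_smul_right_of_hasCompactSupport hψ hs).abs
    · exact (((gReg_contDiff one_pos).continuous.mul hψ).integrable_of_hasCompactSupport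
        hs.mul_left).abs
  have hpos : ∀ᵐ t : E2, t ≠ 0 := by
    simp [ae_iff]
  have hl : ∀ t : E2, Real.log ‖t‖ = 1 / 2 * Real.log (‖t‖ ^ 2) := by
    intro t; rw [Real.log_pow]; push_cast; ring
  refine tendsto_integral_filter_of_dominated_convergence _ ?_ ?_ hI ?_
  · filter_upwards [Filter.eventually_gt_atTop 0] with c hc
    exact ((gReg_contDiff (by positivity)).continuous.mul hψ).aestronglyMeasurable
  · filter_upwards [Filter.eventually_ge_atTop 1] with c hc
    filter_upwards [hpos] with t ht
    have hn : 0 < ‖t‖ := norm_pos_iff.2 ht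
    have h1 : (c ^ 2)⁻¹ ≤ 1 := inv_le_one_of_one_le₀ (one_le_pow₀ hc)
    have h2 : Real.log ‖t‖ ≤ gReg ((c ^ 2)⁻¹) t := by
      rw [hl, gReg]; gcongr; simp; positivity
    have h3 : gReg ((c ^ 2)⁻¹) t ≤ gReg 1 t := by
      unfold gReg; gcongr
    rw [Real.norm_eq_abs, abs_mul, abs_mul, abs_mul, ← add_mul]
    gcongr
    rw [abs_le]
    constructor
    · have := neg_abs_le (Real.log ‖t‖); have := abs_nonneg (gReg 1 t); linarith
    · have := le_abs_self (gReg 1 t); have := abs_nonneg (Real.log ‖t‖); linarith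
  · filter_upwards [hpos] with t ht
    have hn : 0 < ‖t‖ := norm_pos_iff.2 ht
    refine Filter.Tendsto.mul_const _ ?_
    rw [hl]
    unfold gReg
    refine Filter.Tendsto.const_mul _ ?_
    have h5 : Filter.Tendsto (fun c : ℝ => ‖t‖ ^ 2 + (c ^ 2)⁻¹) Filter.atTop
        (nhds (‖t‖ ^ 2 + 0)) :=
      (Filter.tendsto_pow_atTop two_ne_zero).inv_tendsto_atTop.const_add _
    rw [add_zero] at h5
    exact h5.log (by positivity)

theorem log_fundamental {φ : E2 → ℝ} (hφ : ContDiff ℝ 2 φ) (hs : HasCompactSupport φ) :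
    ∫ t, Real.log ‖t‖ * (fderiv ℝ (fun z => fderiv ℝ φ z (EuclideanSpace.single 0 1)) t
      (EuclideanSpace.single 0 1)
    + fderiv ℝ (fun z => fderiv ℝ φ z (EuclideanSpace.single 1 1)) t
      (EuclideanSpace.single 1 1)) = 2 * Real.pi * φ 0 := by
  have hc : ∀ v : E2, Continuous (fun z => fderiv ℝ (fun z => fderiv ℝ φ z v) z v) := fun v =>
    (((hφ.fderiv_right (m := 1) (by norm_num)).clm_apply
      contDiff_const).continuous_fderiv one_ne_zero).clm_apply continuous_const
  have hcs : ∀ v : E2, HasCompactSupport (fun z => fderiv ℝ (fun z => fderiv ℝ φ z v) z v) :=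
    fun v => (hs.fderiv_apply ℝ v).fderiv_apply ℝ v
  have T1 := gReg_tendsto ((hc (EuclideanSpace.single 0 1)).add (hc (EuclideanSpace.single 1 1)))
    ((hcs (EuclideanSpace.single 0 1)).add (hcs (EuclideanSpace.single 1 1)))
  have hp := Real.pi_pos
  have T2 := (tendsto_integral_comp_smul_smul_of_integrable (μ := volume)
    (fun x => by positivity) kernel_integral
    kernel_decay (hφ.continuous.integrable_of_hasCompactSupport hs)
    hφ.continuous.continuousAt).const_mul (2 * Real.pi)
  refine tendsto_nhds_unique (T1.congr' ?_) T2
  filter_upwards [Filter.eventually_gt_atTop 0] with c hc0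
  have ha : 0 < (c ^ 2)⁻¹ := by positivity
  have hg := gReg_contDiff ha
  have hgc : ∀ v : E2, Continuous (fun z => fderiv ℝ (fun z => fderiv ℝ (gReg (c ^ 2)⁻¹) z v) z v) :=
    fun v => (((hg.fderiv_right (m := 1) (by norm_num)).clm_apply
      contDiff_const).continuous_fderiv one_ne_zero).clm_apply continuous_const
  simp only [Pi.add_apply, mul_add]
  have i1 : ∀ v : E2, Integrable (fun t => gReg (c ^ 2)⁻¹ t *
      fderiv ℝ (fun z => fderiv ℝ φ z v) t v) := fun v =>
    (hg.continuous.mul (hc v)).integrable_of_hasCompactSupport (hcs v).mul_left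
  have i2 : ∀ v : E2, Integrable (fun t =>
      fderiv ℝ (fun z => fderiv ℝ (gReg (c ^ 2)⁻¹) z v) t v * φ t) := fun v =>
    ((hgc v).mul hφ.continuous).integrable_of_hasCompactSupport hs.mul_left
  rw [integral_add (i1 _) (i1 _), green_dir hg hφ hs, green_dir hg hφ hs,
    ← integral_add (i2 _) (i2 _),
    ← integral_const_mul]
  congr 1
  ext t
  rw [← add_mul, gReg_lap ha, smul_eq_mul, ← mul_assoc]
  congr 1
  rw [norm_smul, Real.norm_of_nonneg hc0.le]
  simp only [finrank_euclideanSpace_fin]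
  have : (c * ‖t‖) ^ 2 + 1 = c ^ 2 * (‖t‖ ^ 2 + (c ^ 2)⁻¹) := by
    field_simp
  rw [this]
  have h6 : ‖t‖ ^ 2 + (c ^ 2)⁻¹ ≠ 0 := by positivity
  generalize ‖t‖ ^ 2 + (c ^ 2)⁻¹ = q at *
  field_simp

open scoped Convolution in
theorem conv_fderiv {φ : E2 → ℝ} (hφ : ContDiff ℝ 1 φ) (hs : HasCompactSupport φ) (v x : E2) :
    fderiv ℝ ((fun x : E2 => Real.log ‖x‖) ⋆[ContinuousLinearMap.mul ℝ ℝ, volume] φ) x v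
      = ((fun x : E2 => Real.log ‖x‖) ⋆[ContinuousLinearMap.mul ℝ ℝ, volume]
        (fun z => fderiv ℝ φ z v)) x := by
  rw [(hs.hasFDerivAt_convolution_right (ContinuousLinearMap.mul ℝ ℝ) logNorm_locInt hφ x).fderiv]
  exact convolution_precompR_apply _ logNorm_locInt (hs.fderiv ℝ)
    (hφ.continuous_fderiv one_ne_zero) x v

theorem fderiv_refl (f : E2 → ℝ) (x t v : E2) (hf : Differentiable ℝ f) :
    fderiv ℝ (fun s => f (x - s)) t v = - fderiv ℝ f (x - t) v := by
  have h := (hf (x - t)).hasFDerivAt.comp t ((hasFDerivAt_id t).const_sub x)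
  have h' : HasFDerivAt (fun s => f (x - s)) _ t := h
  rw [h'.fderiv]; simp

theorem newtonian_potential_solves_poisson
    (f : EuclideanSpace ℝ (Fin 2) → ℝ)
    (hf : ContDiff ℝ (⊤ : ℕ∞) f) (hsupp : HasCompactSupport f)
    (u : EuclideanSpace ℝ (Fin 2) → ℝ)
    (hu : ∀ x : EuclideanSpace ℝ (Fin 2),
      u x = -(1 / (2 * Real.pi)) * ∫ y : EuclideanSpace ℝ (Fin 2), Real.log ‖x - y‖ * f y) :
    ContDiff ℝ 2 u ∧
    ∀ x : EuclideanSpace ℝ (Fin 2),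
      -((fderiv ℝ (fun z => fderiv ℝ u z (EuclideanSpace.single 0 (1:ℝ))) x)
          (EuclideanSpace.single 0 (1:ℝ))
        + (fderiv ℝ (fun z => fderiv ℝ u z (EuclideanSpace.single 1 (1:ℝ))) x)
          (EuclideanSpace.single 1 (1:ℝ))) = f x := by
  have hf2 : ContDiff ℝ 2 f := contDiff_infty.1 hf 2
  set w : E2 → ℝ := convolution (fun x : E2 => Real.log ‖x‖) f (ContinuousLinearMap.mul ℝ ℝ) volume
    with hw
  have huw : u = fun x => -(1 / (2 * Real.pi)) * w x := by
    ext x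
    rw [hu, hw, convolution_eq_swap]
    simp
  have hw2 : ContDiff ℝ 2 w :=
    hsupp.contDiff_convolution_right (n := 2) _ logNorm_locInt hf2
  refine ⟨huw ▸ contDiff_const.mul hw2, fun x => ?_⟩
  have hd : ∀ v : E2, ContDiff ℝ 1 (fun z => fderiv ℝ f z v) := fun v =>
    (hf2.fderiv_right (m := 1) (by norm_num)).clm_apply contDiff_const
  have hdw : ∀ v : E2, ContDiff ℝ 1 (fun z => fderiv ℝ w z v) := fun v =>
    (hw2.fderiv_right (m := 1) (by norm_num)).clm_apply contDiff_const
  have key : ∀ v : E2, fderiv ℝ (fun z => fderiv ℝ u z v) x v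
      = -(1 / (2 * Real.pi)) *
        ∫ t, Real.log ‖t‖ * fderiv ℝ (fun z => fderiv ℝ f z v) (x - t) v := by
    intro v
    have e1 : (fun z => fderiv ℝ u z v) = fun z => -(1 / (2 * Real.pi)) * fderiv ℝ w z v := by
      ext z
      rw [huw, fderiv_const_mul (hw2.differentiable two_ne_zero z)]
      rfl
    have e2 : (fun z => fderiv ℝ w z v) = convolution (fun x : E2 => Real.log ‖x‖)
        (fun z => fderiv ℝ f z v) (ContinuousLinearMap.mul ℝ ℝ) volume := by
      ext z
      exact conv_fderiv (hf2.of_le (by norm_num)) hsupp v z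
    rw [e1, fderiv_const_mul ((hdw v).differentiable one_ne_zero x), e2]
    rw [smul_apply, conv_fderiv (hd v) (hsupp.fderiv_apply ℝ v)]
    rfl
  rw [key, key]
  have hφ : ContDiff ℝ 2 (fun s => f (x - s)) := hf2.comp (contDiff_const.sub contDiff_id)
  have hφs : HasCompactSupport (fun s => f (x - s)) :=
    hsupp.comp_homeomorph (Homeomorph.subLeft x)
  have L := log_fundamental hφ hφs
  have hr : ∀ v t : E2, fderiv ℝ (fun z => fderiv ℝ (fun s => f (x - s)) z v) t v
      = fderiv ℝ (fun z => fderiv ℝ f z v) (x - t) v := by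
    intro v t
    have : (fun z => fderiv ℝ (fun s => f (x - s)) z v) =
        fun z => -((fun y => fderiv ℝ f y v) (x - z)) := by
      ext z; exact fderiv_refl f x z v (hf2.differentiable two_ne_zero)
    rw [this, fderiv_fun_neg, neg_apply,
      fderiv_refl _ x t v ((hd v).differentiable one_ne_zero), neg_neg]
  simp_rw [hr, mul_add] at L
  have hint : ∀ v : E2, Integrable
      (fun t => Real.log ‖t‖ * fderiv ℝ (fun z => fderiv ℝ f z v) (x - t) v) := by
    intro v
    refine logNorm_locInt.integrable_smul_right_of_hasCompactSupport
      (g := fun t => fderiv ℝ (fun z => fderiv ℝ f z v) (x - t) v) ?_ ?_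
    · exact (((hd v).continuous_fderiv one_ne_zero).clm_apply continuous_const).comp
        (continuous_const.sub continuous_id)
    · exact ((hsupp.fderiv_apply ℝ v).fderiv_apply ℝ v).comp_homeomorph (Homeomorph.subLeft x)
  rw [integral_add (hint _) (hint _)] at L
  rw [← mul_add, L]
  have hp := Real.pi_pos
  simp only [sub_zero]
  field_simp
end

section
/- Let α > 0 and c ∈ ℝ². Then for every x ∈ ℝ², ∫_{ℝ²} −(1/(2π)) log ‖x−y‖ · (4α − 4α²‖y−c‖²) e^{−α‖y−c‖²} dy = e^{−α‖x−c‖²}. -/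
open MeasureTheory

lemma lpg_radial_log {β : ℝ} (hβ : 0 < β) :
    IntegrableOn (fun r : ℝ => r * (Real.log r * Real.exp (-β * r ^ 2))) (Set.Ioi 0) := by
  have h1 : Integrable fun r : ℝ => Real.exp (-β * r ^ 2) := integrable_exp_neg_mul_sq hβ
  have h2 : Integrable fun r : ℝ => r ^ 2 * Real.exp (-β * r ^ 2) := by
    simpa using integrable_rpow_mul_exp_neg_mul_sq hβ (s := 2) (by norm_num)
  refine Integrable.mono' (h1.add h2).integrableOn (by fun_prop) ?_
  refine (ae_restrict_iff' measurableSet_Ioi).2 (Filter.Eventually.of_forall fun r hr => ?_)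
  have hr : 0 < r := hr
  have hb : |Real.log r * r| ≤ 1 + r ^ 2 := by
    rcases le_total r 1 with h | h
    · nlinarith [Real.abs_log_mul_self_lt r hr h]
    · rw [abs_of_nonneg (mul_nonneg (Real.log_nonneg h) hr.le)]
      nlinarith [Real.log_le_sub_one_of_pos hr]
  have e : r * (Real.log r * Real.exp (-β * r ^ 2)) =
    (Real.log r * r) * Real.exp (-β * r ^ 2) := by ring
  rw [e, Real.norm_eq_abs, abs_mul, Real.abs_exp]
  simp only [Pi.add_apply]
  nlinarith [mul_le_mul_of_nonneg_right hb (Real.exp_pos (-β * r ^ 2)).le]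

lemma lpg_bound {α : ℝ} (hα : 0 < α) {t : ℝ} (ht : 0 ≤ t) :
    |(4 * α - 4 * α ^ 2 * t) * Real.exp (-α * t)| ≤ 8 * α * Real.exp (-(α / 2) * t) := by
  rw [abs_mul, Real.abs_exp]
  have h1 : |4 * α - 4 * α ^ 2 * t| ≤ 8 * α * Real.exp (α / 2 * t) := by
    have := Real.add_one_le_exp (α / 2 * t)
    have h3 : 0 ≤ α ^ 2 * t := by positivity
    have h4 := mul_le_mul_of_nonneg_left this hα.le
    rw [abs_le]; constructor <;> nlinarith
  calc _ ≤ 8 * α * Real.exp (α / 2 * t) * Real.exp (-α * t) :=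
        mul_le_mul_of_nonneg_right h1 (Real.exp_pos _).le
    _ = _ := by rw [mul_assoc, ← Real.exp_add]; ring_nf

lemma lpg_radial_int {α : ℝ} (hα : 0 < α) :
    IntegrableOn (fun r : ℝ => r * ((4 * α - 4 * α ^ 2 * r ^ 2) * Real.exp (-α * r ^ 2))
      * Real.log r) (Set.Ioi 0) := by
  have h := ((lpg_radial_log (half_pos hα)).norm).const_mul (8 * α)
  refine Integrable.mono' h (by fun_prop) (Filter.Eventually.of_forall fun r => ?_)
  simp only [norm_mul, Real.norm_eq_abs, Real.abs_exp]
  have := lpg_bound hα (sq_nonneg r)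
  rw [abs_mul, Real.abs_exp] at this
  have := mul_le_mul_of_nonneg_left this (mul_nonneg (abs_nonneg r) (abs_nonneg (Real.log r)))
  linarith

lemma lpg_integrable {α : ℝ} (hα : 0 < α) (w : ℂ) :
    Integrable (fun z : ℂ => Real.log ‖z - w‖ *
      ((4 * α - 4 * α ^ 2 * ‖z‖ ^ 2) * Real.exp (-α * ‖z‖ ^ 2))) := by
  have h0 : Integrable (fun v : ℂ => Real.log ‖v‖ * Real.exp (-(α / 4) * ‖v‖ ^ 2)) := by
    refine (integrable_fun_norm_addHaar (volume : Measure ℂ)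
      (f := fun r : ℝ => Real.log r * Real.exp (-(α / 4) * r ^ 2))).2 ?_
    simpa using lpg_radial_log (β := α / 4) (by positivity)
  have h1 := ((h0.comp_sub_right w).norm).const_mul (8 * α * Real.exp (α / 2 * ‖w‖ ^ 2))
  refine Integrable.mono' h1 (by fun_prop) (Filter.Eventually.of_forall fun z => ?_)
  rw [norm_mul, norm_mul (Real.log _) (Real.exp _), Real.norm_eq_abs, Real.norm_eq_abs,
    Real.norm_eq_abs, Real.abs_exp]
  have hb := lpg_bound hα (sq_nonneg ‖z‖)
  have hn : ‖z - w‖ ^ 2 ≤ 2 * ‖z‖ ^ 2 + 2 * ‖w‖ ^ 2 := by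
    have := norm_sub_le z w
    nlinarith [norm_nonneg (z - w), sq_nonneg (‖z‖ - ‖w‖)]
  have he : Real.exp (-(α / 2) * ‖z‖ ^ 2) ≤
      Real.exp (α / 2 * ‖w‖ ^ 2) * Real.exp (-(α / 4) * ‖z - w‖ ^ 2) := by
    rw [← Real.exp_add]
    apply Real.exp_le_exp.2
    nlinarith
  have := mul_le_mul_of_nonneg_left (hb.trans (mul_le_mul_of_nonneg_left he (by positivity)))
    (abs_nonneg (Real.log ‖z - w‖))
  linarith

lemma lpg_circle (w : ℂ) {r : ℝ} (hr : 0 < r) :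
    ∫ θ in Set.Ioo (-Real.pi) Real.pi,
      Real.log ‖Complex.polarCoord.symm (r, θ) - w‖ =
      2 * Real.pi * (if r ≤ ‖w‖ then Real.log ‖w‖ else Real.log r) := by
  have h := circleAverage_log_norm_sub_const_eq_log_radius_add_posLog (a := w) (c := 0) hr.ne'
  rw [Real.circleAverage_eq_integral_add (-Real.pi)] at h
  rw [intervalIntegral.integral_comp_add_right
    (fun θ => Real.log ‖circleMap 0 r θ - w‖)] at h
  rw [← integral_Ioc_eq_integral_Ioo, ← intervalIntegral.integral_of_le (by linarith [Real.pi_pos])]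
  have e1 : 0 + -Real.pi = -Real.pi := by ring
  have e2 : 2 * Real.pi + -Real.pi = Real.pi := by ring
  rw [e1, e2, smul_eq_mul, inv_mul_eq_iff_eq_mul₀ (by positivity)] at h
  have e3 : ∀ θ : ℝ, Complex.polarCoord.symm (r, θ) = circleMap 0 r θ := fun θ => by
    rw [Complex.polarCoord_symm_apply, circleMap, Complex.exp_mul_I]; simp
  simp only [e3]
  rw [h]
  congr 1
  rw [zero_sub, norm_neg]
  split_ifs with hw
  · have hw0 : 0 < ‖w‖ := hr.trans_le hw
    rw [Real.posLog_eq_log, Real.log_mul (by positivity) hw0.ne', Real.log_inv]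
    · ring
    · rw [abs_of_nonneg (by positivity), inv_mul_eq_div, le_div_iff₀ hr]; linarith
  · rw [Real.posLog_eq_zero_iff _ |>.2, add_zero]
    rw [abs_of_nonneg (by positivity), inv_mul_eq_div, div_le_iff₀ hr]; linarith

lemma lpg_radial {α : ℝ} (hα : 0 < α) {ρ : ℝ} (hρ : 0 ≤ ρ) :
    ∫ r in Set.Ioi (0 : ℝ), r * ((4 * α - 4 * α ^ 2 * r ^ 2) * Real.exp (-α * r ^ 2))
      * (if r ≤ ρ then Real.log ρ else Real.log r) = - Real.exp (-α * ρ ^ 2) := by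
  have hG : ∀ r : ℝ, HasDerivAt (fun r => 2 * α * r ^ 2 * Real.exp (-α * r ^ 2))
      (r * ((4 * α - 4 * α ^ 2 * r ^ 2) * Real.exp (-α * r ^ 2))) r := fun r => by
    have h1 : HasDerivAt (fun r : ℝ => r ^ 2) (2 * r) r := by simpa using hasDerivAt_pow 2 r
    convert! (h1.const_mul (2 * α)).mul ((h1.const_mul (-α)).exp) using 1
    ring
  have hE : ∀ r : ℝ, HasDerivAt (fun r => Real.exp (-α * r ^ 2))
      (Real.exp (-α * r ^ 2) * (-α * (2 * r))) r := fun r => by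
    have h1 : HasDerivAt (fun r : ℝ => r ^ 2) (2 * r) r := by simpa using hasDerivAt_pow 2 r
    exact (h1.const_mul (-α)).exp
  have hcongr1 : Set.EqOn (fun r => r * ((4 * α - 4 * α ^ 2 * r ^ 2) * Real.exp (-α * r ^ 2))
      * (if r ≤ ρ then Real.log ρ else Real.log r))
      (fun r => r * ((4 * α - 4 * α ^ 2 * r ^ 2) * Real.exp (-α * r ^ 2)) * Real.log ρ)
      (Set.Ioc 0 ρ) := fun r hr => by simp [hr.2]
  have hcongr2 : Set.EqOn (fun r => r * ((4 * α - 4 * α ^ 2 * r ^ 2) * Real.exp (-α * r ^ 2))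
      * (if r ≤ ρ then Real.log ρ else Real.log r))
      (fun r => r * ((4 * α - 4 * α ^ 2 * r ^ 2) * Real.exp (-α * r ^ 2)) * Real.log r)
      (Set.Ioi ρ) := fun r hr => by simp [not_le.2 (Set.mem_Ioi.1 hr)]
  have hi1 : IntegrableOn (fun r => r * ((4 * α - 4 * α ^ 2 * r ^ 2) *
      Real.exp (-α * r ^ 2)) * Real.log ρ) (Set.Ioc 0 ρ) :=
    (Continuous.integrableOn_Icc (by fun_prop)).mono_set Set.Ioc_subset_Icc_self
  have hi2 : IntegrableOn (fun r => r * ((4 * α - 4 * α ^ 2 * r ^ 2) *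
      Real.exp (-α * r ^ 2)) * Real.log r) (Set.Ioi ρ) :=
    (lpg_radial_int hα).mono_set (Set.Ioi_subset_Ioi hρ)
  rw [← Set.Ioc_union_Ioi_eq_Ioi hρ, setIntegral_union (Set.Ioc_disjoint_Ioi le_rfl)
    measurableSet_Ioi (hi1.congr_fun hcongr1.symm measurableSet_Ioc)
    (hi2.congr_fun hcongr2.symm measurableSet_Ioi),
    setIntegral_congr_fun measurableSet_Ioc hcongr1,
    setIntegral_congr_fun measurableSet_Ioi hcongr2]
  rw [integral_mul_const, ← intervalIntegral.integral_of_le hρ,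
    intervalIntegral.integral_eq_sub_of_hasDerivAt (fun r _ => hG r)
      (Continuous.intervalIntegrable (by fun_prop) _ _)]
  rw [integral_Ioi_of_hasDerivAt_of_tendsto
    (f := fun r => 2 * α * r * Real.exp (-α * r ^ 2) * (r * Real.log r) + Real.exp (-α * r ^ 2))
    (m := 0) ?_ ?_ hi2 ?_]
  · ring
  · have := Real.continuous_mul_log
    exact Continuous.continuousWithinAt (by fun_prop)
  · intro r hr
    have hr0 : 0 < r := hρ.trans_lt hr
    have h := ((hG r).mul (Real.hasDerivAt_log hr0.ne')).add (hE r)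
    refine (h.congr_deriv ?_).congr_of_eventuallyEq (Filter.Eventually.of_forall fun s => ?_)
    · field_simp; ring
    · simp only [Pi.add_apply, Pi.mul_apply]; ring
  · have hlim : ∀ s : ℝ, Filter.Tendsto (fun r : ℝ => r ^ s * Real.exp (-α * r ^ 2))
        Filter.atTop (nhds 0) := fun s => by
      have := (rpow_mul_exp_neg_mul_sq_isLittleO_exp_neg hα s)
      exact this.trans_tendsto (Real.tendsto_exp_atBot.comp
        (Filter.tendsto_id.const_mul_atTop_of_neg (by norm_num)))
    have h3 := ((hlim 3).const_mul (2 * α))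
    have h0 := hlim 0
    simp only [Real.rpow_zero, one_mul, mul_zero] at h0 h3
    have : Filter.Tendsto (fun r : ℝ => 2 * α * r * Real.exp (-α * r ^ 2) * (r * Real.log r))
        Filter.atTop (nhds 0) := by
      refine squeeze_zero' ?_ ?_ h3
      · filter_upwards [Filter.eventually_ge_atTop 1] with r hr
        have := Real.log_nonneg hr
        positivity
      · filter_upwards [Filter.eventually_ge_atTop 1] with r hr
        have h1 : Real.log r ≤ r := by linarith [Real.log_le_sub_one_of_pos (by linarith : 0 < r)]
        have h2 : 0 ≤ 2 * α * r ^ 2 * Real.exp (-α * r ^ 2) := by positivity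
        have := mul_le_mul_of_nonneg_left h1 h2
        have e : r ^ (3 : ℝ) = r ^ 3 := by norm_cast
        rw [e]
        linarith
    simpa using this.add h0

lemma lpg_complex {α : ℝ} (hα : 0 < α) (w : ℂ) :
    ∫ z : ℂ, Real.log ‖z - w‖ *
      ((4 * α - 4 * α ^ 2 * ‖z‖ ^ 2) * Real.exp (-α * ‖z‖ ^ 2)) =
      -(2 * Real.pi) * Real.exp (-α * ‖w‖ ^ 2) := by
  set F : ℂ → ℝ := fun z => Real.log ‖z - w‖ *
      ((4 * α - 4 * α ^ 2 * ‖z‖ ^ 2) * Real.exp (-α * ‖z‖ ^ 2)) with hF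
  have hint : Integrable F := lpg_integrable hα w
  have hcont : Continuous fun p : ℝ × ℝ => Complex.polarCoord.symm p := by
    simp only [Complex.polarCoord_symm_apply]; fun_prop
  have hint2 : IntegrableOn (fun p : ℝ × ℝ => p.1 • F (Complex.polarCoord.symm p))
      (Set.Ioi 0 ×ˢ Set.Ioo (-Real.pi) Real.pi) (volume.prod volume) := by
    have hm : Measurable F := by fun_prop
    refine ⟨(measurable_fst.smul (hm.comp hcont.measurable)).aestronglyMeasurable, ?_⟩
    have h := hint.2
    rw [HasFiniteIntegral, ← Complex.lintegral_comp_polarCoord_symm] at h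
    refine lt_of_le_of_lt (le_of_eq ?_) h
    refine setLIntegral_congr_fun polarCoord.open_target.measurableSet fun p hp => ?_
    have hp1 : 0 < p.1 := hp.1
    simp only [smul_eq_mul, enorm_mul, Real.enorm_of_nonneg hp1.le]
  rw [← Complex.integral_comp_polarCoord_symm]
  change ∫ p in Set.Ioi 0 ×ˢ Set.Ioo (-Real.pi) Real.pi, p.1 • F (Complex.polarCoord.symm p)
    ∂(volume.prod volume) = _
  rw [setIntegral_prod _ hint2]
  have h3 : ∀ r ∈ Set.Ioi (0 : ℝ), ∫ θ in Set.Ioo (-Real.pi) Real.pi,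
      r • F (Complex.polarCoord.symm (r, θ)) = (2 * Real.pi) *
      (r * ((4 * α - 4 * α ^ 2 * r ^ 2) * Real.exp (-α * r ^ 2))
      * (if r ≤ ‖w‖ then Real.log ‖w‖ else Real.log r)) := fun r hr => by
    simp only [hF, Complex.norm_polarCoord_symm, sq_abs, smul_eq_mul]
    rw [integral_const_mul, integral_mul_const, lpg_circle w hr]
    ring
  rw [setIntegral_congr_fun measurableSet_Ioi h3, integral_const_mul,
    lpg_radial hα (norm_nonneg w)]
  ring

/-- The Gaussian `e^{-α‖x-c‖²}` is the logarithmic potential of its negative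
Laplacian: for `α > 0`, `c ∈ ℝ²`, and every `x ∈ ℝ²`,
`∫_{ℝ²} -(1/(2π)) log ‖x-y‖ (4α - 4α²‖y-c‖²) e^{-α‖y-c‖²} dy = e^{-α‖x-c‖²}`. -/
theorem log_potential_of_gaussian (α : ℝ) (hα : 0 < α)
    (c x : EuclideanSpace ℝ (Fin 2)) :
    ∫ y : EuclideanSpace ℝ (Fin 2),
        (-(1 / (2 * Real.pi))) * Real.log ‖x - y‖ *
          ((4 * α - 4 * α ^ 2 * ‖y - c‖ ^ 2) * Real.exp (-α * ‖y - c‖ ^ 2))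
      = Real.exp (-α * ‖x - c‖ ^ 2) := by
  let e := Complex.orthonormalBasisOneI.repr
  rw [← integral_add_right_eq_self _ c]
  rw [← (LinearIsometryEquiv.measurePreserving e).integral_comp
    e.toHomeomorph.measurableEmbedding]
  have h := lpg_complex hα (e.symm (x - c))
  have h2 : ∀ z : ℂ, ‖x - (e z + c)‖ = ‖z - e.symm (x - c)‖ := fun z => by
    rw [← e.norm_map (z - _), map_sub, e.apply_symm_apply, norm_sub_rev]
    congr 1; abel
  simp only [add_sub_cancel_right, h2, e.norm_map, mul_assoc]
  rw [integral_const_mul]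
  simp only [mul_assoc] at h
  rw [h, e.symm.norm_map]
  have := Real.pi_pos
  field_simp
end

section
/- Let κ > 0 and define u : ℝ² \ {0} → ℝ by u(x) = ∫_0^∞ exp(−κ‖x‖ cosh t) dt. Then for every x ≠ 0, −(∂²u/∂x₁²(x) + ∂²u/∂x₂²(x)) + κ² u(x) = 0; that is, u satisfies the homogeneous equation −Δu + κ²u = 0 away from the origin. -/
open Set MeasureTheory

namespace BesselAux

/-- The integrals `∫_0^∞ cosh^n t exp(-a cosh t) dt`. -/
noncomputable def I (n : ℕ) (a : ℝ) : ℝ :=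
  ∫ t in Ioi (0:ℝ), Real.cosh t ^ n * Real.exp (-(a * Real.cosh t))

lemma le_cosh (t : ℝ) (ht : 0 ≤ t) : t ≤ Real.cosh t :=
  (Real.self_le_sinh_iff.2 ht).trans (Real.sinh_lt_cosh t).le

lemma bound (n : ℕ) (a : ℝ) (ha : 0 < a) (t : ℝ) (ht : 0 ≤ t) :
    Real.cosh t ^ n * Real.exp (-(a * Real.cosh t)) ≤
      (n.factorial / (a / 2) ^ n) * Real.exp (-(a / 2) * t) := by
  have hc : 0 < Real.cosh t := Real.cosh_pos t
  have h1 := Real.pow_div_factorial_le_exp (a / 2 * Real.cosh t) (by positivity) n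
  have hf : (0:ℝ) < n.factorial := by positivity
  have hp : 0 < (a / 2) ^ n := by positivity
  have h2 : Real.cosh t ^ n ≤ (n.factorial / (a / 2) ^ n) * Real.exp (a / 2 * Real.cosh t) := by
    rw [div_le_iff₀ hf, mul_pow] at h1
    rw [div_mul_eq_mul_div, le_div_iff₀ hp]
    linarith
  have h3 : Real.exp (-(a / 2 * Real.cosh t)) ≤ Real.exp (-(a / 2) * t) := by
    apply Real.exp_le_exp.2
    nlinarith [le_cosh t ht]
  calc _ ≤ (n.factorial / (a / 2) ^ n) * Real.exp (a / 2 * Real.cosh t)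
        * Real.exp (-(a * Real.cosh t)) := by gcongr
    _ = (n.factorial / (a / 2) ^ n) * Real.exp (-(a / 2 * Real.cosh t)) := by
        rw [mul_assoc, ← Real.exp_add]; congr 2; ring
    _ ≤ _ := by gcongr

lemma integrable (n : ℕ) (a : ℝ) (ha : 0 < a) :
    IntegrableOn (fun t => Real.cosh t ^ n * Real.exp (-(a * Real.cosh t))) (Ioi 0) := by
  have h := (integrableOn_exp_mul_Ioi (a := -(a / 2)) (by linarith) 0).const_mul
    (n.factorial / (a / 2) ^ n : ℝ)
  refine Integrable.mono' h ?_ ?_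
  · exact Continuous.aestronglyMeasurable (by fun_prop)
  · refine (ae_restrict_iff' measurableSet_Ioi).2 (Filter.Eventually.of_forall fun t ht => ?_)
    have hc : 0 < Real.cosh t := Real.cosh_pos t
    rw [Real.norm_of_nonneg (by positivity)]
    exact bound n a ha t (le_of_lt ht)

lemma hasDerivAt_I (n : ℕ) (a : ℝ) (ha : 0 < a) : HasDerivAt (I n) (-I (n + 1) a) a := by
  have h := hasDerivAt_integral_of_dominated_loc_of_deriv_le (μ := volume.restrict (Ioi (0:ℝ)))
    (F := fun a t => Real.cosh t ^ n * Real.exp (-(a * Real.cosh t)))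
    (F' := fun a t => -(Real.cosh t ^ (n + 1) * Real.exp (-(a * Real.cosh t))))
    (bound := fun t => Real.cosh t ^ (n + 1) * Real.exp (-(a / 2 * Real.cosh t)))
    (s := Ioi (a / 2)) (x₀ := a) (Ioi_mem_nhds (by linarith))
    (Filter.Eventually.of_forall fun x => Continuous.aestronglyMeasurable (by fun_prop))
    (integrable n a ha) (Continuous.aestronglyMeasurable (by fun_prop))
    (Filter.Eventually.of_forall fun t x hx => ?_) (integrable (n + 1) (a / 2) (by linarith))
    (Filter.Eventually.of_forall fun t x hx => ?_)
  · have h2 := h.2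
    rw [integral_neg] at h2
    exact h2
  · have hc : 0 < Real.cosh t := Real.cosh_pos t
    have hx' : a / 2 < x := hx
    rw [norm_neg, Real.norm_of_nonneg (by positivity)]
    gcongr
  · have h1 : HasDerivAt (fun x : ℝ => -(x * Real.cosh t)) (-(1 * Real.cosh t)) x :=
      ((hasDerivAt_id x).mul_const _).neg
    refine (h1.exp.const_mul (Real.cosh t ^ n)).congr_deriv ?_
    ring

lemma ode (a : ℝ) (ha : 0 < a) : a * (I 2 a - I 0 a) = I 1 a := by
  have hi : ∀ n, IntegrableOn (fun t => Real.cosh t ^ n * Real.exp (-(a * Real.cosh t))) (Ioi 0) :=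
    fun n => integrable n a ha
  have h := integral_Ioi_of_hasDerivAt_of_tendsto' (a := (0:ℝ)) (m := 0)
    (f := fun t => Real.sinh t * Real.exp (-(a * Real.cosh t)))
    (f' := fun t => Real.cosh t ^ 1 * Real.exp (-(a * Real.cosh t))
      - a * (Real.cosh t ^ 2 * Real.exp (-(a * Real.cosh t))
        - Real.cosh t ^ 0 * Real.exp (-(a * Real.cosh t)))) ?_
    ((hi 1).sub (((hi 2).sub (hi 0)).const_mul a)) ?_
  · have h20 : IntegrableOn (fun t => a * (Real.cosh t ^ 2 * Real.exp (-(a * Real.cosh t))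
        - Real.cosh t ^ 0 * Real.exp (-(a * Real.cosh t)))) (Ioi 0) :=
      ((hi 2).sub (hi 0)).const_mul a
    rw [integral_sub (hi 1) h20, integral_const_mul,
      integral_sub (hi 2) (hi 0)] at h
    simp only [Real.sinh_zero, zero_mul, sub_zero] at h
    unfold I
    linarith
  · intro t _
    have h1 : HasDerivAt (fun t : ℝ => -(a * Real.cosh t)) (-(a * Real.sinh t)) t :=
      ((Real.hasDerivAt_cosh t).const_mul a).neg
    refine ((Real.hasDerivAt_sinh t).mul h1.exp).congr_deriv ?_
    have := Real.cosh_sq t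
    linear_combination (a * Real.exp (-(a * Real.cosh t))) * this
  · have hlim : Filter.Tendsto (fun t : ℝ => (((Nat.factorial 1 : ℕ) : ℝ) / (a / 2) ^ 1) *
        Real.exp (-(a / 2) * t)) Filter.atTop (nhds 0) := by
      have he : Filter.Tendsto (fun t : ℝ => Real.exp (-(a / 2) * t)) Filter.atTop (nhds 0) :=
        Real.tendsto_exp_atBot.comp (Filter.tendsto_id.const_mul_atTop_of_neg (by linarith))
      have hm := he.const_mul (((Nat.factorial 1 : ℕ) : ℝ) / (a / 2) ^ 1)
      rwa [mul_zero] at hm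
    refine squeeze_zero' ?_ ?_ hlim
    · filter_upwards [Filter.eventually_ge_atTop 0] with t ht
      have := Real.sinh_nonneg_iff.2 ht
      positivity
    · filter_upwards [Filter.eventually_ge_atTop 0] with t ht
      refine le_trans ?_ (bound 1 a ha t ht)
      rw [pow_one]
      have := (Real.sinh_lt_cosh t).le
      gcongr

abbrev E := EuclideanSpace ℝ (Fin 2)

lemma hasFDerivAt_nrm (x : E) (hx : x ≠ 0) :
    HasFDerivAt (fun z : E => ‖z‖) (‖x‖⁻¹ • innerSL ℝ x) x := by
  have h0 : 0 < ‖x‖ := norm_pos_iff.2 hx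
  have h := (hasStrictFDerivAt_norm_sq x).hasFDerivAt.sqrt (by positivity)
  simp only [Real.sqrt_sq (norm_nonneg _)] at h
  refine h.congr_fderiv ?_
  ext v
  simp only [smul_apply, smul_eq_mul, nsmul_eq_mul]
  push_cast
  field_simp

lemma main (κ : ℝ) (hκ : 0 < κ) (u : E → ℝ) (hu : ∀ x, u x = I 0 (κ * ‖x‖)) (x : E) (hx : x ≠ 0)
    (i : Fin 2) :
    (fderiv ℝ (fun z => fderiv ℝ u z (EuclideanSpace.single i (1:ℝ))) x)
      (EuclideanSpace.single i (1:ℝ)) =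
    -κ * I 1 (κ * ‖x‖) / ‖x‖ + x i ^ 2 / ‖x‖ *
      (κ ^ 2 * I 2 (κ * ‖x‖) / ‖x‖ + κ * I 1 (κ * ‖x‖) / ‖x‖ ^ 2) := by
  have hI : ∀ n, ∀ z : E, z ≠ 0 → HasDerivAt (fun r : ℝ => I n (κ * r))
      (-I (n + 1) (κ * ‖z‖) * κ) ‖z‖ := by
    intro n z hz
    have h0 : 0 < ‖z‖ := norm_pos_iff.2 hz
    have h1 : HasDerivAt (fun r : ℝ => κ * r) κ ‖z‖ := by
      simpa using (hasDerivAt_id ‖z‖).const_mul κ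
    exact (hasDerivAt_I n (κ * ‖z‖) (by positivity)).comp ‖z‖ h1
  have huf : u = fun z => I 0 (κ * ‖z‖) := funext hu
  have h1 : ∀ z : E, z ≠ 0 → fderiv ℝ u z (EuclideanSpace.single i (1:ℝ)) =
      (-I 1 (κ * ‖z‖) * κ / ‖z‖) * z i := by
    intro z hz
    have h := (hI 0 z hz).comp_hasFDerivAt z (hasFDerivAt_nrm z hz)
    rw [← show u = (fun r : ℝ => I 0 (κ * r)) ∘ (fun z : E => ‖z‖) from huf] at h
    rw [h.fderiv]
    simp [EuclideanSpace.inner_single_right]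
    ring
  have h2 : (fun z => fderiv ℝ u z (EuclideanSpace.single i (1:ℝ))) =ᶠ[nhds x]
      fun z => (-I 1 (κ * ‖z‖) * κ / ‖z‖) * z i := by
    filter_upwards [isOpen_ne.mem_nhds hx] with z hz using h1 z hz
  have h0 : 0 < ‖x‖ := norm_pos_iff.2 hx
  rw [h2.fderiv_eq]
  have hg := (((hI 1 x hx).neg.mul_const κ).div (hasDerivAt_id ‖x‖) h0.ne').comp_hasFDerivAt x
    (hasFDerivAt_nrm x hx)
  have hp : HasFDerivAt (fun z : E => z i) (EuclideanSpace.proj i : E →L[ℝ] ℝ) x :=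
    (EuclideanSpace.proj i : E →L[ℝ] ℝ).hasFDerivAt
  have h3 : HasFDerivAt (fun z : E => (-I 1 (κ * ‖z‖) * κ / ‖z‖) * z i) _ x := hg.mul hp
  rw [h3.fderiv]
  simp [EuclideanSpace.inner_single_right]
  field_simp

end BesselAux

/-- For `κ > 0`, the function `u(x) = ∫_0^∞ exp(-κ‖x‖ cosh t) dt`
(`= K₀(κ‖x‖)`, the modified Bessel function of the second kind of order zero) satisfies
`-Δu + κ²u = 0` away from the origin in `ℝ²`. -/
theorem bessel_K0_solves_modified_helmholtz (κ : ℝ) (hκ : 0 < κ)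
    (u : EuclideanSpace ℝ (Fin 2) → ℝ)
    (hu : ∀ x : EuclideanSpace ℝ (Fin 2),
      u x = ∫ t in Ioi (0:ℝ), Real.exp (-(κ * ‖x‖ * Real.cosh t))) :
    ∀ x : EuclideanSpace ℝ (Fin 2), x ≠ 0 →
      -((fderiv ℝ (fun z => fderiv ℝ u z (EuclideanSpace.single 0 (1:ℝ))) x)
            (EuclideanSpace.single 0 (1:ℝ))
          + (fderiv ℝ (fun z => fderiv ℝ u z (EuclideanSpace.single 1 (1:ℝ))) x)
            (EuclideanSpace.single 1 (1:ℝ)))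
        + κ ^ 2 * u x = 0 := by

  intro x hx
  have hu' : ∀ x, u x = BesselAux.I 0 (κ * ‖x‖) := by
    intro x; rw [hu x]; simp [BesselAux.I]
  have h0 : 0 < ‖x‖ := norm_pos_iff.2 hx
  rw [BesselAux.main κ hκ u hu' x hx 0, BesselAux.main κ hκ u hu' x hx 1, hu' x]
  have ho := BesselAux.ode (κ * ‖x‖) (by positivity)
  have hn : ‖x‖ ^ 2 = x 0 ^ 2 + x 1 ^ 2 := by
    rw [EuclideanSpace.norm_sq_eq, Fin.sum_univ_two]; simp
  generalize BesselAux.I 0 (κ * ‖x‖) = A at *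
  generalize BesselAux.I 2 (κ * ‖x‖) = C at *
  rw [← ho]
  have hx0 : x 0 ^ 2 = ‖x‖ ^ 2 - x 1 ^ 2 := by linarith
  rw [hx0]
  field_simp
  ring
end
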